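/- Let L be a regular language over a finite alphabet Σ and let A be the minimal (reduced) complete deterministic finite automaton accepting L, with transition graph Γ. Then L is piecewise testable if and only if: (i) Γ is acyclic, i.e., for all states p, q, if p ⪰ q and q ⪰ p then p = q; and (ii) for every state p, the maximal connected component C of the graph Γ(Σ(p)) that contains p has a unique maximal state, i.e., C contains exactly one state m such that every state reachable from m by edges of Γ(Σ(p)) equals m. -/

import Mathlib

/-- Extended transition function of a DFA. -/
def deltaStar {Q A : Type*} (δ : Q → A → Q) (q : Q) (w : List A) : Q :=
  w.foldl δ q

/-- `p ⪰ q` : the state `q` is reachable from `p`. -/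
def Reach {Q A : Type*} (δ : Q → A → Q) (p q : Q) : Prop :=
  ∃ w : List A, deltaStar δ p w = q

/-- The stabilizer `Σ(p)` of a state `p`: the set of letters `σ` with `δ(p,σ) = p`. -/
def Stab {Q A : Type*} (δ : Q → A → Q) (p : Q) : Set A :=
  {σ : A | δ p σ = p}

/-- The edge relation of the graph `Γ(Sig)`: edges of `Γ` whose labels lie in `Sig`. -/
def Edge {Q A : Type*} (δ : Q → A → Q) (Sig : Set A) (p q : Q) : Prop :=
  ∃ σ ∈ Sig, δ p σ = q

/-- Reachability inside the graph `Γ(Sig)` (directed paths). -/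
def ReachIn {Q A : Type*} (δ : Q → A → Q) (Sig : Set A) : Q → Q → Prop :=
  Relation.ReflTransGen (Edge δ Sig)

/-- Connectivity inside the graph `Γ(Sig)` (ignoring edge direction):
the reflexive-transitive-symmetric closure of the edge relation. -/
def Conn {Q A : Type*} (δ : Q → A → Q) (Sig : Set A) : Q → Q → Prop :=
  Relation.ReflTransGen (fun a b => Edge δ Sig a b ∨ Edge δ Sig b a)

/-- Piecewise testable languages over `A`: the Boolean algebra generated by the
languages `Σ*a₁Σ*a₂Σ*···Σ*a_kΣ*`, closed under complementation and finite union. -/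
inductive PiecewiseTestable {A : Type*} : Set (List A) → Prop
  | basic (l : List A) : PiecewiseTestable {w : List A | List.Sublist l w}
  | compl {L : Set (List A)} : PiecewiseTestable L → PiecewiseTestable Lᶜ
  | union {L₁ L₂ : Set (List A)} :
      PiecewiseTestable L₁ → PiecewiseTestable L₂ → PiecewiseTestable (L₁ ∪ L₂)

/-- Two words are `n`-equivalent if they have the same subwords of length at most `n`. -/
def SubwordEquiv {A : Type*} (n : ℕ) (u v : List A) : Prop :=
  ∀ r : List A, r.length ≤ n → (r.Sublist u ↔ r.Sublist v)

namespace SubwordEquiv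

variable {A : Type*} {n : ℕ} {u v w : List A}

theorem symm (h : SubwordEquiv n u v) : SubwordEquiv n v u :=
  fun r hr => (h r hr).symm

theorem trans (h : SubwordEquiv n u v) (h' : SubwordEquiv n v w) : SubwordEquiv n u w :=
  fun r hr => (h r hr).trans (h' r hr)

theorem mono {m : ℕ} (hmn : m ≤ n) (h : SubwordEquiv n u v) : SubwordEquiv m u v :=
  fun r hr => h r (hr.trans hmn)

theorem of_sublist (huv : u.Sublist v) (h : ∀ r : List A, r.length ≤ n → r.Sublist v → r.Sublist u) :
    SubwordEquiv n u v :=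
  fun r hr => ⟨fun hu => hu.trans huv, h r hr⟩

theorem append {u' v' : List A} (h : SubwordEquiv n u v) (h' : SubwordEquiv n u' v') :
    SubwordEquiv n (u ++ u') (v ++ v') := by
  intro r hr
  simp only [List.sublist_append_iff]
  constructor
  · rintro ⟨x, y, rfl, hx, hy⟩
    simp only [List.length_append] at hr
    exact ⟨x, y, rfl, (h x (by omega)).1 hx, (h' y (by omega)).1 hy⟩
  · rintro ⟨x, y, rfl, hx, hy⟩
    simp only [List.length_append] at hr
    exact ⟨x, y, rfl, (h x (by omega)).2 hx, (h' y (by omega)).2 hy⟩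

theorem refl (n : ℕ) (u : List A) : SubwordEquiv n u u := fun _ _ => Iff.rfl

end SubwordEquiv

section Words

variable {A : Type*}

theorem sublist_flatten_replicate {w : List A} :
    ∀ (r : List A) (n : ℕ), r.length ≤ n → (∀ b ∈ r, b ∈ w) →
      r.Sublist (List.replicate n w).flatten := by
  intro r
  induction r with
  | nil => intro n _ _; exact List.nil_sublist _
  | cons c r ih =>
    intro n hn hw
    obtain _ | n := n
    · simp at hn
    · rw [List.replicate_succ, List.flatten_cons]
      have h1 : [c].Sublist w := List.singleton_sublist.2 (hw c (by simp))
      have h2 := ih n (by simpa using hn) (fun b hb => hw b (by simp [hb]))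
      exact h1.append h2

/-- Prepending or appending letters of `w` to `wⁿ` does not change its subwords of length `≤ n`. -/
theorem subwordEquiv_power (n : ℕ) {w x y : List A} (hx : ∀ b ∈ x, b ∈ w) (hy : ∀ b ∈ y, b ∈ w) :
    SubwordEquiv n (List.replicate n w).flatten (x ++ (List.replicate n w).flatten ++ y) := by
  refine SubwordEquiv.of_sublist ?_ fun r hr hsub => sublist_flatten_replicate r n hr fun b hb => ?_
  · exact (List.sublist_append_right _ _).trans (List.sublist_append_left _ _)
  · have := hsub.subset hb
    simp only [List.mem_append, List.mem_flatten, List.mem_replicate] at this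
    rcases this with (h | ⟨l, ⟨_, rfl⟩, h⟩) | h
    · exact hx b h
    · exact h
    · exact hy b h

theorem sublist_append_of_not_sublist {s t u v : List A} {a : A}
    (h : (s ++ a :: t).Sublist (u ++ v)) (hs : ¬ (s ++ [a]).Sublist u) : (a :: t).Sublist v := by
  obtain ⟨x, y, hxy, hx, hy⟩ := List.sublist_append_iff.1 h
  rcases List.append_eq_append_iff.1 hxy with ⟨z, rfl, hz⟩ | ⟨z, rfl, rfl⟩
  · rcases z with _ | ⟨c, z⟩
    · simpa [hz] using hy
    · simp only [List.cons_append, List.cons.injEq] at hz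
      obtain ⟨rfl, rfl⟩ := hz
      refine absurd (List.Sublist.trans ?_ hx) hs
      exact List.Sublist.append (List.Sublist.refl s) (by simp)
  · exact (List.sublist_append_right z _).trans hy

/-- If inserting `b` at a position of `u ++ v` creates the new subword `r`, then `r` uses the
inserted letter. -/
theorem exists_split_of_insert {u v r : List A} {b : A} (h : r.Sublist (u ++ b :: v))
    (hn : ¬ r.Sublist (u ++ v)) :
    ∃ r₁ r₂, r = r₁ ++ b :: r₂ ∧ r₁.Sublist u ∧ r₂.Sublist v ∧ ¬ (r₁ ++ [b]).Sublist u := by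
  obtain ⟨x, y, rfl, hx, hy⟩ := List.sublist_append_iff.1 h
  rcases List.sublist_cons_iff.1 hy with hy | ⟨r₂, rfl, hr₂⟩
  · exact absurd (hx.append hy) hn
  · refine ⟨x, r₂, rfl, hx, hr₂, fun hb => hn ?_⟩
    simpa using hb.append hr₂

/-- If inserting `a` does not change the subwords of length `≤ 2k`, then the insertion is
invisible at level `k` either on the left or on the right. -/
theorem insert_left_or_right {k : ℕ} {u v : List A} {a : A}
    (h : SubwordEquiv (2 * k) (u ++ v) (u ++ a :: v)) :
    (∀ r : List A, r.length ≤ k → r.Sublist (u ++ [a]) → r.Sublist u) ∨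
      ∀ r : List A, r.length ≤ k → r.Sublist (a :: v) → r.Sublist v := by
  by_contra! hc
  obtain ⟨⟨r, hr, hru, hrn⟩, s, hs, hsv, hsn⟩ := hc
  obtain ⟨r₁, r₂, rfl, hr₁, hr₂, hr₁a⟩ :=
    exists_split_of_insert (v := []) hru (by simpa using hrn)
  rcases List.sublist_cons_iff.1 hsv with hsv | ⟨s₁, rfl, hs₁⟩
  · exact hsn hsv
  · simp only [List.length_append, List.length_cons] at hr hs
    have h1 : (r₁ ++ a :: s₁).Sublist (u ++ a :: v) := hr₁.append (hs₁.cons_cons a)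
    have h2 := (h _ (by simp only [List.length_append, List.length_cons]; omega)).2 h1
    exact hsn (sublist_append_of_not_sublist h2 hr₁a)

/-- The length estimate behind `subwordEquiv_insert`. -/
theorem lt_length_of_new_subwords {n : ℕ} {u v w r₁ r₂ s₁ : List A} {a b : A}
    (hab : a ≠ b) (h : SubwordEquiv n (u ++ a :: v) (u ++ b :: w))
    (hr : (r₁ ++ b :: r₂).length ≤ n) (hr₁ : r₁.Sublist u) (hr₂ : r₂.Sublist (a :: v))
    (hrn : ¬ (r₁ ++ b :: r₂).Sublist (u ++ a :: v))
    (hs₁ : s₁.Sublist u) (hs₁a : ¬ (s₁ ++ [a]).Sublist u) :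
    n < s₁.length + 1 + r₂.length := by
  by_contra! hlen
  have key : ∀ t : List A, t.Sublist v → (s₁ ++ a :: t).length ≤ n → (a :: t).Sublist w := by
    intro t ht htn
    have h1 := (h _ htn).1 (hs₁.append (ht.cons_cons a))
    rcases List.sublist_cons_iff.1 (sublist_append_of_not_sublist h1 hs₁a) with h2 | ⟨z, hz, -⟩
    · exact h2
    · exact absurd (List.cons.inj hz).1 hab
  have hw : r₂.Sublist w := by
    rcases List.sublist_cons_iff.1 hr₂ with h2 | ⟨t, rfl, ht⟩
    · exact (List.sublist_cons_self a r₂).trans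
        (key r₂ h2 (by simp only [List.length_append, List.length_cons]; omega))
    · exact key t ht (by simp only [List.length_append, List.length_cons] at *; omega)
  exact hrn ((h _ hr).2 (hr₁.append (hw.cons_cons b)))

/-- At the first position where two `n`-equivalent words differ, the letter of one of them can be
inserted into the other one within the equivalence class. -/
theorem subwordEquiv_insert {n : ℕ} {u v w : List A} {a b : A} (hab : a ≠ b)
    (h : SubwordEquiv n (u ++ a :: v) (u ++ b :: w)) :
    SubwordEquiv n (u ++ a :: v) (u ++ b :: a :: v) ∨
      SubwordEquiv n (u ++ b :: w) (u ++ a :: b :: w) := by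
  by_contra! hc
  have aux : ∀ (b : A) (t : List A), ¬ SubwordEquiv n (u ++ t) (u ++ b :: t) →
      ∃ r : List A, r.length ≤ n ∧ r.Sublist (u ++ b :: t) ∧ ¬ r.Sublist (u ++ t) := by
    intro b t ht
    by_contra! hcon
    exact ht (SubwordEquiv.of_sublist
      ((List.Sublist.refl u).append (List.sublist_cons_self b t)) hcon)
  obtain ⟨r, hr, hrs, hrn⟩ := aux _ _ hc.1
  obtain ⟨s, hs, hss, hsn⟩ := aux _ _ hc.2
  obtain ⟨r₁, r₂, rfl, hr₁, hr₂, hr₁b⟩ := exists_split_of_insert hrs hrn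
  obtain ⟨s₁, s₂, rfl, hs₁, hs₂, hs₁a⟩ := exists_split_of_insert hss hsn
  have h1 := lt_length_of_new_subwords hab h hr hr₁ hr₂ hrn hs₁ hs₁a
  have h2 := lt_length_of_new_subwords hab.symm h.symm hs hs₁ hs₂ hsn hr₁ hr₁b
  simp only [List.length_append, List.length_cons] at hr hs
  omega

/-- The shortest suffix containing every letter of a nonempty word. -/
theorem exists_full_suffix : ∀ v : List A, v ≠ [] →
    ∃ x c y, v = x ++ c :: y ∧ c ∉ y ∧ ∀ b ∈ v, b ∈ c :: y := by
  intro v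
  induction v with
  | nil => intro h; exact absurd rfl h
  | cons b t ih =>
    intro _
    by_cases hb : b ∈ t
    · obtain ⟨x, c, y, rfl, hc, hall⟩ := ih (List.ne_nil_of_mem hb)
      refine ⟨b :: x, c, y, rfl, hc, fun d hd => ?_⟩
      rcases List.mem_cons.1 hd with rfl | hd
      · exact hall _ hb
      · exact hall _ hd
    · exact ⟨[], b, t, rfl, hb, fun d hd => hd⟩

/-- A function on words which is unchanged by insertions of letters that preserve the
`n`-equivalence class is constant on `n`-equivalence classes. -/
theorem eq_of_subwordEquiv_of_insert {β : Type*} {n : ℕ} (f : List A → β)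
    (hf : ∀ (u v : List A) (a : A), SubwordEquiv n (u ++ v) (u ++ a :: v) →
      f (u ++ v) = f (u ++ a :: v)) {v w : List A} (h : SubwordEquiv n v w) : f v = f w := by
  suffices H : ∀ (N : ℕ) (u v w : List A), v.length + w.length ≤ N →
      SubwordEquiv n (u ++ v) (u ++ w) → f (u ++ v) = f (u ++ w) from H _ [] v w le_rfl h
  clear h v w
  have nil_case : ∀ (w u : List A), SubwordEquiv n u (u ++ w) → f u = f (u ++ w) := by
    intro w
    induction w with
    | nil => intro u _; simp
    | cons b w ih =>
      intro u h
      have h1 : SubwordEquiv n u (u ++ [b]) :=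
        SubwordEquiv.of_sublist (List.sublist_append_left _ _) fun r hr hrs =>
          (h r hr).2 (hrs.trans ((List.Sublist.refl u).append (by simp)))
      have h2 : f u = f (u ++ [b]) := by
        simpa using hf u [] b (by simpa using h1)
      have h3 := ih (u ++ [b]) (by simpa using h1.symm.trans h)
      rw [h2, h3]
      simp
  intro N
  induction N with
  | zero =>
    intro u v w hN _
    have hv : v = [] := List.length_eq_zero_iff.1 (by omega)
    have hw : w = [] := List.length_eq_zero_iff.1 (by omega)
    rw [hv, hw]
  | succ N ih =>
    intro u v w hN h
    rcases v with _ | ⟨a, v⟩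
    · simpa using nil_case w u (by simpa using h)
    rcases w with _ | ⟨b, w⟩
    · simpa using (nil_case (a :: v) u (by simpa using h.symm)).symm
    simp only [List.length_cons] at hN
    by_cases hab : a = b
    · subst hab
      simpa using ih (u ++ [a]) v w (by omega) (by simpa using h)
    rcases subwordEquiv_insert hab h with h1 | h1
    · rw [hf u (a :: v) b h1]
      simpa using ih (u ++ [b]) (a :: v) w (by simp only [List.length_cons]; omega)
        (by simpa using h1.symm.trans h)
    · rw [hf u (b :: w) a h1]
      simpa using ih (u ++ [a]) v (b :: w) (by simp only [List.length_cons]; omega)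
        (by simpa using h.trans h1)

end Words

section Languages

variable {A : Type*}

theorem PiecewiseTestable.inter {L₁ L₂ : Set (List A)} (h₁ : PiecewiseTestable L₁)
    (h₂ : PiecewiseTestable L₂) : PiecewiseTestable (L₁ ∩ L₂) := by
  rw [← compl_compl (L₁ ∩ L₂), Set.compl_inter]
  exact (h₁.compl.union h₂.compl).compl

theorem PiecewiseTestable.univ : PiecewiseTestable (Set.univ : Set (List A)) := by
  have h := PiecewiseTestable.basic ([] : List A)
  simpa using h

theorem PiecewiseTestable.exists_subwordEquiv {L : Set (List A)} (h : PiecewiseTestable L) :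
    ∃ n, ∀ u v, SubwordEquiv n u v → (u ∈ L ↔ v ∈ L) := by
  induction h with
  | basic l => exact ⟨l.length, fun u v h => h l le_rfl⟩
  | compl _ ih =>
    obtain ⟨n, hn⟩ := ih
    exact ⟨n, fun u v h => not_congr (hn u v h)⟩
  | union _ _ ih₁ ih₂ =>
    obtain ⟨n, hn⟩ := ih₁
    obtain ⟨m, hm⟩ := ih₂
    exact ⟨max n m, fun u v h => or_congr (hn u v (h.mono (le_max_left _ _)))
      (hm u v (h.mono (le_max_right _ _)))⟩

/-- A language which only depends on which words of a finite set are subwords is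
piecewise testable. -/
theorem piecewiseTestable_of_finite {T : Set (List A)} (hT : T.Finite) :
    ∀ L : Set (List A),
      (∀ u v : List A, (∀ t ∈ T, (t.Sublist u ↔ t.Sublist v)) → u ∈ L → v ∈ L) →
      PiecewiseTestable L := by
  induction T, hT using Set.Finite.induction_on with
  | empty =>
    intro L hL
    by_cases h : ∃ u, u ∈ L
    · obtain ⟨u, hu⟩ := h
      have : L = Set.univ := Set.eq_univ_of_forall fun v => hL u v (by simp) hu
      rw [this]
      exact PiecewiseTestable.univ
    · have : L = Set.univᶜ := by
        ext v
        simpa using fun hv => h ⟨v, hv⟩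
      rw [this]
      exact PiecewiseTestable.univ.compl
  | @insert t T _ _ ih =>
    intro L hL
    have hsat : ∀ P : List A → Prop, PiecewiseTestable
        {w | ∃ u ∈ L, P u ∧ ∀ s ∈ T, (s.Sublist u ↔ s.Sublist w)} := by
      intro P
      refine ih _ ?_
      rintro u v huv ⟨x, hx, hP, hxu⟩
      exact ⟨x, hx, hP, fun s hs => (hxu s hs).trans (huv s hs)⟩
    have heq : L =
        ({w | t.Sublist w} ∩
          {w | ∃ u ∈ L, t.Sublist u ∧ ∀ s ∈ T, (s.Sublist u ↔ s.Sublist w)}) ∪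
        ({w | t.Sublist w}ᶜ ∩
          {w | ∃ u ∈ L, ¬ t.Sublist u ∧ ∀ s ∈ T, (s.Sublist u ↔ s.Sublist w)}) := by
      ext w
      constructor
      · intro hw
        by_cases ht : t.Sublist w
        · exact Or.inl ⟨ht, w, hw, ht, fun _ _ => Iff.rfl⟩
        · exact Or.inr ⟨ht, w, hw, ht, fun _ _ => Iff.rfl⟩
      · rintro (⟨ht, u, hu, htu, h⟩ | ⟨ht, u, hu, htu, h⟩)
        · refine hL u w (fun s hs => ?_) hu
          rcases hs with rfl | hs
          · exact iff_of_true htu ht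
          · exact h s hs
        · refine hL u w (fun s hs => ?_) hu
          rcases hs with rfl | hs
          · exact iff_of_false htu ht
          · exact h s hs
    rw [heq]
    exact ((PiecewiseTestable.basic t).inter (hsat _)).union
      ((PiecewiseTestable.basic t).compl.inter (hsat _))

end Languages

section Automata

variable {Q A : Type*} {δ : Q → A → Q}

@[simp]
theorem deltaStar_append (δ : Q → A → Q) (q : Q) (u v : List A) :
    deltaStar δ q (u ++ v) = deltaStar δ (deltaStar δ q u) v :=
  List.foldl_append

@[simp]
theorem deltaStar_nil (δ : Q → A → Q) (q : Q) : deltaStar δ q [] = q := rfl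

@[simp]
theorem deltaStar_cons (δ : Q → A → Q) (q : Q) (a : A) (v : List A) :
    deltaStar δ q (a :: v) = deltaStar δ (δ q a) v := rfl

theorem deltaStar_eq_self {q : Q} {w : List A} (h : ∀ b ∈ w, δ q b = q) :
    deltaStar δ q w = q := by
  induction w with
  | nil => rfl
  | cons b w ih =>
    rw [deltaStar_cons, h b (by simp)]
    exact ih fun c hc => h c (by simp [hc])

theorem deltaStar_flatten_replicate {q : Q} {w : List A} (h : deltaStar δ q w = q) (n : ℕ) :
    deltaStar δ q (List.replicate n w).flatten = q := by
  induction n with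
  | zero => rfl
  | succ n ih => rw [List.replicate_succ, List.flatten_cons, deltaStar_append, h, ih]

theorem Reach.trans {p q r : Q} (h : Reach δ p q) (h' : Reach δ q r) : Reach δ p r := by
  obtain ⟨u, rfl⟩ := h
  obtain ⟨v, rfl⟩ := h'
  exact ⟨u ++ v, deltaStar_append δ p u v⟩

theorem reach_of_reachIn {Sig : Set A} {p q : Q} (h : ReachIn δ Sig p q) : Reach δ p q := by
  induction h with
  | refl => exact ⟨[], rfl⟩
  | tail _ h ih =>
    obtain ⟨σ, _, rfl⟩ := h
    exact ih.trans ⟨[σ], rfl⟩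

theorem Conn.symm {Sig : Set A} {p q : Q} (h : Conn δ Sig p q) : Conn δ Sig q p :=
  have : Std.Symm (fun a b => Edge δ Sig a b ∨ Edge δ Sig b a) := ⟨fun _ _ => Or.symm⟩
  Relation.ReflTransGen.stdSymm.symm _ _ h

theorem Conn.mono {Sig Sig' : Set A} (hs : Sig ⊆ Sig') {p q : Q} (h : Conn δ Sig p q) :
    Conn δ Sig' p q :=
  Relation.ReflTransGen.mono (fun _ _ => Or.imp (fun ⟨σ, h, e⟩ => ⟨σ, hs h, e⟩)
    (fun ⟨σ, h, e⟩ => ⟨σ, hs h, e⟩)) _ _ h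

theorem ReachIn.conn {Sig : Set A} {p q : Q} (h : ReachIn δ Sig p q) : Conn δ Sig p q :=
  Relation.ReflTransGen.mono (fun _ _ => Or.inl) _ _ h

theorem reachIn_deltaStar {Sig : Set A} {w : List A} (hw : ∀ b ∈ w, b ∈ Sig) (p : Q) :
    ReachIn δ Sig p (deltaStar δ p w) := by
  induction w generalizing p with
  | nil => exact Relation.ReflTransGen.refl
  | cons b w ih =>
    exact Relation.ReflTransGen.head ⟨b, hw b (by simp), rfl⟩
      (ih (fun c hc => hw c (by simp [hc])) _)

theorem eq_of_reachIn_of_fixed {Sig : Set A} {p q : Q} (hp : ∀ σ ∈ Sig, δ p σ = p)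
    (h : ReachIn δ Sig p q) : q = p := by
  induction h with
  | refl => rfl
  | tail _ h ih =>
    obtain ⟨σ, hσ, rfl⟩ := h
    rw [ih, hp σ hσ]

/-- The number of states reachable from `p`. -/
noncomputable def reachRank (δ : Q → A → Q) (p : Q) : ℕ :=
  {q | Reach δ p q}.ncard

section Acyclic

variable [Finite Q]

theorem reachRank_le_of_reach {p q : Q} (h : Reach δ p q) : reachRank δ q ≤ reachRank δ p :=
  Set.ncard_le_ncard (fun _ hr => h.trans hr) (Set.toFinite _)

theorem reachRank_lt (hac : ∀ p q : Q, Reach δ p q → Reach δ q p → p = q) {p : Q} {a : A}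
    (h : δ p a ≠ p) : reachRank δ (δ p a) < reachRank δ p := by
  have hr : Reach δ p (δ p a) := ⟨[a], rfl⟩
  refine Set.ncard_lt_ncard ⟨fun _ h' => hr.trans h', fun hsub => h ?_⟩ (Set.toFinite _)
  exact (hac p _ hr (hsub ⟨[], rfl⟩)).symm

theorem fixed_of_reachRank_eq (hac : ∀ p q : Q, Reach δ p q → Reach δ q p → p = q)
    {p : Q} {w : List A} (h : reachRank δ p ≤ reachRank δ (deltaStar δ p w)) :
    ∀ b ∈ w, δ p b = p := by
  induction w with
  | nil => simp
  | cons c w ih =>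
    have hc : δ p c = p := by
      by_contra hne
      have h1 := reachRank_lt hac hne
      have h2 : reachRank δ (deltaStar δ (δ p c) w) ≤ reachRank δ (δ p c) :=
        reachRank_le_of_reach ⟨w, rfl⟩
      rw [deltaStar_cons] at h
      omega
    intro b hb
    rcases List.mem_cons.1 hb with rfl | hb
    · exact hc
    · rw [deltaStar_cons, hc] at h
      exact ih h b hb

theorem exists_reachIn_sink (hac : ∀ p q : Q, Reach δ p q → Reach δ q p → p = q)
    (Sig : Set A) (p : Q) : ∃ m, ReachIn δ Sig p m ∧ ∀ σ ∈ Sig, δ m σ = m := by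
  induction hN : reachRank δ p using Nat.strong_induction_on generalizing p with
  | _ N ih =>
    by_cases h : ∀ σ ∈ Sig, δ p σ = p
    · exact ⟨p, Relation.ReflTransGen.refl, h⟩
    · push Not at h
      obtain ⟨σ, hσ, hne⟩ := h
      obtain ⟨m, hm, hfix⟩ := ih _ (hN ▸ reachRank_lt hac hne) (δ p σ) rfl
      exact ⟨m, Relation.ReflTransGen.head ⟨σ, hσ, rfl⟩ hm, hfix⟩

/-- Under the graph conditions, a connected component of `Γ(Sig)` contains at most one state
fixed by all letters of `Sig`. -/
theorem eq_of_conn_of_fixed (hac : ∀ p q : Q, Reach δ p q → Reach δ q p → p = q)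
    (huniq : ∀ p : Q, ∃! m : Q, Conn δ (Stab δ p) p m ∧
      ∀ q : Q, ReachIn δ (Stab δ p) m q → q = m)
    {Sig : Set A} {p q : Q} (hp : ∀ σ ∈ Sig, δ p σ = p) (hq : ∀ σ ∈ Sig, δ q σ = q)
    (h : Conn δ Sig p q) : p = q := by
  have key : ∀ p q : Q, (∀ σ ∈ Sig, δ p σ = p) → Conn δ Sig p q → Reach δ q p := by
    intro p q hp h
    obtain ⟨m, hm, hfix⟩ := exists_reachIn_sink hac (Stab δ p) q
    have hpm : m = p := (huniq p).unique
      ⟨(h.mono hp).trans hm.conn, fun _ => eq_of_reachIn_of_fixed hfix⟩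
      ⟨Relation.ReflTransGen.refl, fun _ => eq_of_reachIn_of_fixed fun _ hσ => hσ⟩
    exact hpm ▸ reach_of_reachIn hm
  exact hac p q (key q p hq h.symm) (key p q hp h)

/-- A letter moving the state reached by `u` creates a short new subword. -/
theorem exists_new_subword_right (hac : ∀ p q : Q, Reach δ p q → Reach δ q p → p = q) {a : A} :
    ∀ (u : List A) (q : Q), δ (deltaStar δ q u) a ≠ deltaStar δ q u →
      ∃ c r, δ q c ≠ q ∧ (c :: r).length ≤ reachRank δ q ∧ (c :: r).Sublist (u ++ [a]) ∧
        ¬ (c :: r).Sublist u := by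
  intro u
  induction u with
  | nil =>
    intro q hq
    have := reachRank_lt hac hq
    exact ⟨a, [], hq, by simp only [List.length_singleton]; simp at this; omega, by simp, by simp⟩
  | cons b u ih =>
    intro q hq
    obtain ⟨c, r, hc, hlen, hsub, hn⟩ := ih (δ q b) hq
    by_cases hb : δ q b = q
    · rw [hb] at hc hlen
      refine ⟨c, r, hc, hlen, hsub.trans (List.sublist_cons_self b _), fun hs => ?_⟩
      rcases List.sublist_cons_iff.1 hs with hs | ⟨z, hz, -⟩
      · exact hn hs
      · exact hc ((List.cons.inj hz).1 ▸ hb)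
    · have := reachRank_lt hac hb
      refine ⟨b, c :: r, hb, ?_, hsub.cons_cons b, fun hs => hn (List.cons_sublist_cons.1 hs)⟩
      simp only [List.length_cons] at hlen ⊢
      omega

/-- If a leading letter `a` of `a :: v` creates no new subword of length `≤ k`, then the states
reached along `v` and `a :: v` are equal or both paths together make at least `k` moves. -/
theorem eq_or_reachRank_drop (hac : ∀ p q : Q, Reach δ p q → Reach δ q p → p = q)
    (huniq : ∀ p : Q, ∃! m : Q, Conn δ (Stab δ p) p m ∧
      ∀ q : Q, ReachIn δ (Stab δ p) m q → q = m) {a : A} (q : Q) :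
    ∀ (k : ℕ) (v : List A),
      (∀ r : List A, r.length ≤ k → r.Sublist (a :: v) → r.Sublist v) →
      deltaStar δ q v = deltaStar δ (δ q a) v ∨
        reachRank δ (deltaStar δ q v) + reachRank δ (deltaStar δ (δ q a) v) + k ≤
          reachRank δ q + reachRank δ (δ q a) := by
  intro k
  induction k with
  | zero =>
    intro v _
    have h : ∀ p, reachRank δ (deltaStar δ p v) ≤ reachRank δ p :=
      fun p => reachRank_le_of_reach ⟨v, rfl⟩
    exact Or.inr (by simpa using Nat.add_le_add (h q) (h (δ q a)))
  | succ k ih =>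
    intro v hv
    have ha : a ∈ v := List.singleton_sublist.1 (hv [a] (by simp) (by simp))
    obtain ⟨x, c, y, rfl, hcy, hall⟩ := exists_full_suffix v (List.ne_nil_of_mem ha)
    have hx : ∀ r : List A, r.length ≤ k → r.Sublist (a :: x) → r.Sublist x := by
      intro r hr hrx
      have h1 : (r ++ [c]).Sublist (a :: (x ++ c :: y)) :=
        hrx.append (show [c].Sublist (c :: y) by simp)
      have h2 := hv _ (by simpa using hr) h1
      by_contra hrn
      have h3 : ¬ (r ++ [c]).Sublist (x ++ [c]) := by simpa using hrn
      have h4 := sublist_append_of_not_sublist (u := x ++ [c]) (v := y) (t := [])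
        (by simpa using h2) h3
      exact hcy (List.singleton_sublist.1 h4)
    rcases ih x hx with h | h
    · left
      rw [deltaStar_append, deltaStar_append, h]
    rw [deltaStar_append, deltaStar_append]
    set p₁ := deltaStar δ q x with hp₁
    set p₂ := deltaStar δ (δ q a) x with hp₂
    have l₁ : reachRank δ (deltaStar δ p₁ (c :: y)) ≤ reachRank δ p₁ :=
      reachRank_le_of_reach ⟨_, rfl⟩
    have l₂ : reachRank δ (deltaStar δ p₂ (c :: y)) ≤ reachRank δ p₂ :=
      reachRank_le_of_reach ⟨_, rfl⟩
    by_cases hlt : reachRank δ p₁ ≤ reachRank δ (deltaStar δ p₁ (c :: y)) ∧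
        reachRank δ p₂ ≤ reachRank δ (deltaStar δ p₂ (c :: y))
    · left
      have f₁ := fixed_of_reachRank_eq hac hlt.1
      have f₂ := fixed_of_reachRank_eq hac hlt.2
      have hxB : ∀ b ∈ x, b ∈ {b | b ∈ c :: y} := fun b hb => hall b (by simp [hb])
      have c₁ : Conn δ {b | b ∈ c :: y} q p₁ := (reachIn_deltaStar hxB q).conn
      have c₂ : Conn δ {b | b ∈ c :: y} q p₂ :=
        (reachIn_deltaStar (w := a :: x)
          (fun b hb => (List.mem_cons.1 hb).elim (fun e => e ▸ hall a ha) (hxB b)) q).conn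
      rw [eq_of_conn_of_fixed hac huniq f₁ f₂ (c₁.symm.trans c₂)]
    · right
      omega

theorem deltaStar_eq_of_subwordEquiv (hac : ∀ p q : Q, Reach δ p q → Reach δ q p → p = q)
    (huniq : ∀ p : Q, ∃! m : Q, Conn δ (Stab δ p) p m ∧
      ∀ q : Q, ReachIn δ (Stab δ p) m q → q = m) (q : Q) {u v : List A}
    (h : SubwordEquiv (2 * (2 * Nat.card Q + 1)) u v) : deltaStar δ q u = deltaStar δ q v := by
  have hcard : ∀ p, reachRank δ p ≤ Nat.card Q := fun p => Set.ncard_le_card _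
  refine eq_of_subwordEquiv_of_insert (deltaStar δ q) (fun u v a hins => ?_) h
  rw [deltaStar_append, deltaStar_append, deltaStar_cons]
  rcases insert_left_or_right hins with hl | hr
  · suffices hfix : δ (deltaStar δ q u) a = deltaStar δ q u by rw [hfix]
    by_contra hne
    obtain ⟨c, r, -, hlen, hsub, hn⟩ := exists_new_subword_right hac u q hne
    exact hn (hl _ (by have := hcard q; omega) hsub)
  · rcases eq_or_reachRank_drop hac huniq (deltaStar δ q u) _ v hr with h | h
    · exact h
    · have := hcard (deltaStar δ q u)
      have := hcard (δ (deltaStar δ q u) a)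
      omega

end Acyclic

section Necessity

variable {n : ℕ}

theorem acyclic_of_subwordEquiv
    (hδ : ∀ (q : Q) (u v : List A), SubwordEquiv n u v → deltaStar δ q u = deltaStar δ q v)
    (p q : Q) (hpq : Reach δ p q) (hqp : Reach δ q p) : p = q := by
  obtain ⟨u, rfl⟩ := hpq
  obtain ⟨v, hv⟩ := hqp
  have h := hδ p _ _ (subwordEquiv_power n (w := u ++ v) (x := []) (y := u) (by simp)
    (fun b hb => by simp [hb]))
  have hW := deltaStar_flatten_replicate (δ := δ) (q := p) (w := u ++ v)
    (by rw [deltaStar_append, hv]) n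
  rw [List.nil_append, deltaStar_append, hW] at h
  exact h

theorem unique_sink_of_subwordEquiv [Finite A]
    (hδ : ∀ (q : Q) (u v : List A), SubwordEquiv n u v → deltaStar δ q u = deltaStar δ q v)
    (p : Q) : ∃! m : Q, Conn δ (Stab δ p) p m ∧ ∀ q : Q, ReachIn δ (Stab δ p) m q → q = m := by
  refine ⟨p, ⟨Relation.ReflTransGen.refl, fun _ => eq_of_reachIn_of_fixed fun _ hσ => hσ⟩, ?_⟩
  rintro m ⟨hconn, hm⟩
  have hfix : ∀ σ ∈ Stab δ p, δ m σ = m :=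
    fun σ hσ => hm _ (Relation.ReflTransGen.single ⟨σ, hσ, rfl⟩)
  set w : List A := (Set.toFinite (Stab δ p)).toFinset.toList with hw
  have hmem : ∀ b, b ∈ w ↔ b ∈ Stab δ p := fun b => by simp [hw]
  set W := (List.replicate n w).flatten with hW
  have hstep : ∀ r s : Q, Edge δ (Stab δ p) r s → deltaStar δ r W = deltaStar δ s W := by
    rintro r s ⟨σ, hσ, rfl⟩
    have h := hδ r _ _ (subwordEquiv_power n (w := w) (x := [σ]) (y := [])
      (by simpa using (hmem σ).2 hσ) (by simp))
    simpa using h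
  have hconst : deltaStar δ p W = deltaStar δ m W := by
    clear hm hfix
    induction hconn with
    | refl => rfl
    | tail _ h ih => exact ih.trans (h.elim (hstep _ _) fun h => (hstep _ _ h).symm)
  have hpW : deltaStar δ p W = p :=
    deltaStar_flatten_replicate (deltaStar_eq_self fun b hb => (hmem b).1 hb) n
  have hmW : deltaStar δ m W = m :=
    deltaStar_flatten_replicate (deltaStar_eq_self fun b hb => hfix b ((hmem b).1 hb)) n
  rw [← hpW, hconst, hmW]

end Necessity

end Automata

/-- Trahtman's criterion: a regular language `L`, accepted by its minimal
(reduced) complete DFA with transition graph `Γ`, is piecewise testable iff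
(i) `Γ` is acyclic, and (ii) for every state `p` the maximal connected component
of `Γ(Σ(p))` containing `p` has a unique maximal state. -/
theorem piecewise_testable_iff_graph_conditions
    {Q A : Type*} [Fintype Q] [Fintype A]
    (δ : Q → A → Q) (q0 : Q) (Fset : Set Q) (L : Set (List A))
    (hreach : ∀ q : Q, Reach δ q0 q)
    (hdist : ∀ p q : Q, p ≠ q →
      ∃ w : List A, ¬(deltaStar δ p w ∈ Fset ↔ deltaStar δ q w ∈ Fset))
    (hacc : L = {w : List A | deltaStar δ q0 w ∈ Fset}) :
    PiecewiseTestable L ↔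
      ((∀ p q : Q, Reach δ p q → Reach δ q p → p = q) ∧
        ∀ p : Q, ∃! m : Q, Conn δ (Stab δ p) p m ∧
          ∀ q : Q, ReachIn δ (Stab δ p) m q → q = m) := by
  constructor
  · intro hL
    obtain ⟨n, hn⟩ := hL.exists_subwordEquiv
    have hδ : ∀ (q : Q) (u v : List A), SubwordEquiv n u v →
        deltaStar δ q u = deltaStar δ q v := by
      intro q u v huv
      by_contra hne
      obtain ⟨x, rfl⟩ := hreach q
      obtain ⟨y, hy⟩ := hdist _ _ hne
      refine hy ?_
      have h := hn _ _ (((SubwordEquiv.refl n x).append huv).append (SubwordEquiv.refl n y))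
      simpa [hacc] using h
    exact ⟨acyclic_of_subwordEquiv hδ, unique_sink_of_subwordEquiv hδ⟩
  · rintro ⟨hac, huniq⟩
    refine piecewiseTestable_of_finite
      (List.finite_length_le A (2 * (2 * Nat.card Q + 1))) L fun u v h hu => ?_
    rw [hacc] at hu ⊢
    have heq := deltaStar_eq_of_subwordEquiv hac huniq q0 (u := u) (v := v) fun r hr => h r hr
    simpa [← heq] using hu
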